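/- The El Gordo transform is injective but not surjective on probability measures on ℝ: (i) if μ and ν are probability measures with μ^♭ = ν^♭, then μ = ν; (ii) for every p ∈ ℝ with p ≠ 0, there is no probability measure ν on ℝ with ν^♭ = δ_p, the point mass at p. -/

import Mathlib

open MeasureTheory Complex

/-- The Cauchy transform of a measure on ℝ. -/
noncomputable def cauchy (μ : Measure ℝ) (z : ℂ) : ℂ := ∫ t, (z - (t : ℂ))⁻¹ ∂μ

open FourierTransform in
lemma charFun_cont_aux (μ : Measure ℝ) [IsProbabilityMeasure μ] : Continuous (charFun μ) := by
  have h : charFun μ = fun t : ℝ => ∫ x : ℝ, Complex.exp (t * x * I) ∂μ := by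
    ext t; exact charFun_apply_real t
  rw [h]
  refine continuous_of_dominated (bound := fun _ => 1) ?_ ?_ (integrable_const _) ?_
  · intro t
    exact (by fun_prop : Continuous fun x : ℝ => Complex.exp (t * x * I)).aestronglyMeasurable
  · intro t
    refine Filter.Eventually.of_forall fun x => ?_
    rw [← Complex.ofReal_mul, Complex.norm_exp_ofReal_mul_I]
  · exact Filter.Eventually.of_forall fun x => by fun_prop

noncomputable def auxF (μ : Measure ℝ) : ℝ → ℂ :=
  Set.indicator (Set.Ioi 0) (fun s : ℝ => Complex.exp (((-1 : ℝ) : ℂ) * s) * charFun μ (-s))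

lemma auxF_integrable (μ : Measure ℝ) [IsProbabilityMeasure μ] : Integrable (auxF μ) := by
  unfold auxF
  rw [integrable_indicator_iff measurableSet_Ioi]
  refine Integrable.mul_bdd (c := 1) ?_ ?_ ?_
  · exact integrableOn_exp_mul_complex_Ioi (by simp) 0
  · exact ((charFun_cont_aux μ).comp continuous_neg).aestronglyMeasurable
  · exact Filter.Eventually.of_forall fun s => norm_charFun_le_one _

open FourierTransform in
lemma auxF_fourier (μ : Measure ℝ) [IsProbabilityMeasure μ] (w : ℝ) :
    𝓕 (auxF μ) w = I * cauchy μ (((-2 * Real.pi * w : ℝ) : ℂ) + I) := by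
  rw [Real.fourier_real_eq_integral_exp_smul]
  have h1 : ∀ v : ℝ, Complex.exp (((-2 * Real.pi * v * w : ℝ) : ℂ) * I) • auxF μ v =
      Set.indicator (Set.Ioi 0) (fun s : ℝ =>
        ∫ t : ℝ, Complex.exp ((-1 - I * (2 * Real.pi * w + t)) * s) ∂μ) v := by
    intro v
    unfold auxF
    by_cases hv : v ∈ Set.Ioi (0:ℝ)
    · rw [Set.indicator_of_mem hv, Set.indicator_of_mem hv, charFun_apply_real, smul_eq_mul,
        ← mul_assoc, ← Complex.exp_add, ← integral_const_mul]
      congr 1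
      ext t
      rw [← Complex.exp_add]
      congr 1
      push_cast
      ring
    · simp [Set.indicator_of_notMem hv]
  simp_rw [h1]
  rw [integral_indicator measurableSet_Ioi, integral_integral_swap]
  · unfold cauchy
    rw [← integral_const_mul]
    congr 1
    ext t
    rw [integral_exp_mul_complex_Ioi (by simp)]
    have e : (-1 - I * (2 * Real.pi * w + t) : ℂ) = I * (((-2 * Real.pi * w : ℝ) : ℂ) + I - t) := by
      push_cast
      linear_combination - I_mul_I
    rw [e]
    simp only [ofReal_zero, mul_zero, Complex.exp_zero]
    rw [neg_div, one_div, mul_inv, Complex.inv_I]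
    ring
  · have hb : Integrable (fun p : ℝ × ℝ => Complex.exp (((-1 : ℝ) : ℂ) * p.1) * (1:ℂ))
        ((volume.restrict (Set.Ioi (0:ℝ))).prod μ) :=
      Integrable.mul_prod (f := fun s : ℝ => Complex.exp (((-1 : ℝ) : ℂ) * s)) (g := fun _ => (1:ℂ))
        (integrableOn_exp_mul_complex_Ioi (by simp) 0) (integrable_const _)
    refine hb.mono ?_ ?_
    · refine Continuous.aestronglyMeasurable ?_
      unfold Function.uncurry
      fun_prop
    · refine Filter.Eventually.of_forall fun p => ?_
      simp [Function.uncurry, Complex.norm_exp]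

open FourierTransform in
lemma cauchy_inj (μ ν : Measure ℝ) [IsProbabilityMeasure μ] [IsProbabilityMeasure ν]
    (h : ∀ z : ℂ, 0 < z.im → cauchy μ z = cauchy ν z) : μ = ν := by
  have hF : 𝓕 (auxF μ) = 𝓕 (auxF ν) := by
    ext w
    rw [auxF_fourier, auxF_fourier, h _ (by simp)]
  have hsub : 𝓕 (auxF μ - auxF ν) = 0 := by
    ext w
    have := congrFun hF w
    rw [Real.fourier_real_eq_integral_exp_smul] at this ⊢
    rw [Real.fourier_real_eq_integral_exp_smul] at this
    simp only [Pi.sub_apply, smul_sub]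
    have hi : ∀ ρ : Measure ℝ, IsProbabilityMeasure ρ → Integrable
        (fun v : ℝ => Complex.exp (((-2 * Real.pi * v * w : ℝ) : ℂ) * I) • auxF ρ v) := by
      intro ρ _
      refine Integrable.bdd_mul (c := 1) (auxF_integrable ρ) ?_ ?_
      · exact (by fun_prop : Continuous fun v : ℝ =>
          Complex.exp (((-2 * Real.pi * v * w : ℝ) : ℂ) * I)).aestronglyMeasurable
      · exact Filter.Eventually.of_forall fun v => by rw [Complex.norm_exp_ofReal_mul_I]
    rw [integral_sub (hi μ inferInstance) (hi ν inferInstance), this, sub_self]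
    rfl
  have hpos : ∀ s : ℝ, 0 < s → charFun μ (-s) = charFun ν (-s) := by
    intro s hs
    have hc : ∀ ρ : Measure ℝ, IsProbabilityMeasure ρ → ContinuousAt (auxF ρ) s := by
      intro ρ _
      have hcont : Continuous (fun s : ℝ => Complex.exp (((-1 : ℝ) : ℂ) * s) * charFun ρ (-s)) :=
        Continuous.mul (by fun_prop) ((charFun_cont_aux ρ).comp continuous_neg)
      refine hcont.continuousAt.congr ?_
      filter_upwards [Ioi_mem_nhds hs] with x hx
      rw [auxF, Set.indicator_of_mem hx]
    have key := MeasureTheory.Integrable.fourierInv_fourier_eq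
      ((auxF_integrable μ).sub (auxF_integrable ν))
      (by rw [hsub]; exact integrable_zero _ _ _)
      ((hc μ inferInstance).sub (hc ν inferInstance))
    rw [hsub] at key
    have k2 : 𝓕⁻ (0 : ℝ → ℂ) s = 0 := by
      rw [Real.fourierInv_eq]; simp
    rw [k2] at key
    simp only [Pi.sub_apply, auxF] at key
    rw [Set.indicator_of_mem (Set.mem_Ioi.2 hs), Set.indicator_of_mem (Set.mem_Ioi.2 hs),
      ← mul_sub] at key
    have := (mul_eq_zero.1 key.symm).resolve_left (Complex.exp_ne_zero _)
    exact sub_eq_zero.1 this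
  refine Measure.ext_of_charFun ?_
  ext t
  rcases lt_trichotomy t 0 with ht | ht | ht
  · simpa using hpos (-t) (by linarith)
  · subst ht; simp [charFun_zero]
  · have := hpos t ht
    rw [charFun_neg, charFun_neg] at this
    exact (starRingEnd ℂ).injective this

/-- the El Gordo transform is injective but not surjective:
(i) if a probability measure ρ is simultaneously the El Gordo transform of μ and of ν
then μ = ν; (ii) for p ≠ 0, no probability measure ν has El Gordo transform δ_p. -/
theorem elGordo_injective_not_surjective :
    (∀ μ ν ρ : Measure ℝ,
      IsProbabilityMeasure μ → IsProbabilityMeasure ν → IsProbabilityMeasure ρ →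
      (∀ z : ℂ, 0 < z.im → (cauchy ρ z) ^ 2 = cauchy μ z / z) →
      (∀ z : ℂ, 0 < z.im → (cauchy ρ z) ^ 2 = cauchy ν z / z) →
      μ = ν) ∧
    (∀ p : ℝ, p ≠ 0 →
      ¬ ∃ ν : Measure ℝ, IsProbabilityMeasure ν ∧
        ∀ z : ℂ, 0 < z.im → (cauchy (Measure.dirac p) z) ^ 2 = cauchy ν z / z) := by
  refine ⟨?_, ?_⟩
  · intro μ ν ρ hμ hν _ h1 h2
    refine cauchy_inj μ ν fun z hz => ?_
    have hz0 : z ≠ 0 := by rintro rfl; simp at hz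
    have := (h1 z hz).symm.trans (h2 z hz)
    exact (div_left_inj' hz0).1 this
  · rintro p hp ⟨ν, hν, h⟩
    have hp' : 0 < |p| := abs_pos.2 hp
    set y : ℝ := |p| / 2 with hy
    have hy0 : 0 < y := by positivity
    set z : ℂ := (p : ℂ) + y * I with hz
    have him : z.im = y := by simp [hz]
    have hre : z.re = p := by simp [hz]
    have hh := h z (by rw [him]; exact hy0)
    have hz0 : z ≠ 0 := by intro h0; rw [h0] at him; simp at him; linarith
    have hd : cauchy (Measure.dirac p) z = (y * I : ℂ)⁻¹ := by
      simp [cauchy, hz]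
    have hbound : ‖cauchy ν z‖ ≤ y⁻¹ := by
      unfold cauchy
      have := norm_integral_le_of_norm_le_const (μ := ν) (C := y⁻¹)
        (f := fun t : ℝ => (z - (t : ℂ))⁻¹) (Filter.Eventually.of_forall fun t => by
          rw [norm_inv]
          refine inv_anti₀ hy0 ?_
          have h3 := Complex.abs_im_le_norm (z - (t : ℂ))
          have h4 : (z - (t : ℂ)).im = y := by simp [him]
          rw [h4] at h3
          exact (le_abs_self y).trans h3)
      simpa using this
    have hzn : |p| ≤ ‖z‖ := by
      have := Complex.abs_re_le_norm z
      rwa [hre] at this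
    rw [eq_div_iff hz0, hd] at hh
    have hn : ‖cauchy ν z‖ = (y⁻¹) ^ 2 * ‖z‖ := by
      rw [← hh, norm_mul, norm_pow, norm_inv, norm_mul]
      simp [abs_of_pos hy0]
    rw [hn] at hbound
    have h5 : (y⁻¹) ^ 2 * |p| ≤ y⁻¹ := le_trans (by gcongr) hbound
    have h6 : |p| = 2 * y := by rw [hy]; ring
    rw [h6] at h5
    have h7 : (y⁻¹) ^ 2 * (2 * y) = 2 * y⁻¹ := by field_simp
    rw [h7] at h5
    have : 0 < y⁻¹ := by positivity
    linarith
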